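/- For every real number t with |t| < 1, the series ∑_{k=0}^∞ H_k²·t^k converges and equals [Li₂(t) + ln²(1−t)]/(1−t), where Li₂(t) = ∑_{k=1}^∞ t^k/k² is the dilogarithm. -/

import Mathlib

/-- The `k`-th harmonic number `H_k = ∑_{j=1}^k 1/j`, with `H_0 = 0`. -/
noncomputable def H (k : ℕ) : ℝ := ∑ j ∈ Finset.range k, (1 : ℝ) / (j + 1)

/-- The dilogarithm `Li₂(t) = ∑_{k=1}^∞ t^k / k²`. -/
noncomputable def Li2 (t : ℝ) : ℝ := ∑' k : ℕ, t ^ (k + 1) / ((k : ℝ) + 1) ^ 2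

theorem H_succ (m : ℕ) : H (m + 1) = H m + 1 / ((m : ℝ) + 1) :=
  Finset.sum_range_succ _ _

theorem sum_range_inv_mul_inv_reflect (m : ℕ) :
    ∑ i ∈ Finset.range m, (1 / ((i : ℝ) + 1)) * (1 / (((m - 1 - i : ℕ) : ℝ) + 1)) =
      2 * H m / (m + 1) := by
  have hrefl : ∑ i ∈ Finset.range m, 1 / (((m - 1 - i : ℕ) : ℝ) + 1) = H m :=
    Finset.sum_range_reflect (fun j : ℕ => (1 : ℝ) / (j + 1)) m
  have hsum : ∑ i ∈ Finset.range m,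
      (1 / ((i : ℝ) + 1)) * (1 / (((m - 1 - i : ℕ) : ℝ) + 1)) =
      ∑ i ∈ Finset.range m,
        (1 / ((i : ℝ) + 1) + 1 / (((m - 1 - i : ℕ) : ℝ) + 1)) / (m + 1) := by
    refine Finset.sum_congr rfl fun i hi => ?_
    have hi' : i < m := Finset.mem_range.1 hi
    obtain ⟨j, rfl⟩ : ∃ j, m = i + j + 1 := ⟨m - 1 - i, by omega⟩
    have hj : i + j + 1 - 1 - i = j := by omega
    rw [hj]
    push_cast
    have h1 : (i : ℝ) + 1 ≠ 0 := by positivity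
    have h2 : (j : ℝ) + 1 ≠ 0 := by positivity
    have h3 : (i : ℝ) + j + 1 + 1 ≠ 0 := by positivity
    field_simp
    ring
  rw [hsum, ← Finset.sum_div, Finset.sum_add_distrib, hrefl, two_mul]
  rfl

theorem sum_range_pow_div_mul_pow_div (t : ℝ) (m : ℕ) :
    ∑ i ∈ Finset.range (m + 1 + 1), t ^ i / (i : ℝ) * (t ^ (m + 1 - i) / ((m + 1 - i : ℕ) : ℝ)) =
      2 * H m / (m + 1) * t ^ (m + 1) := by
  rw [Finset.sum_range_succ, Finset.sum_range_succ', ← sum_range_inv_mul_inv_reflect,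
    Finset.sum_mul]
  simp only [Nat.sub_self, Nat.cast_zero, div_zero, mul_zero, zero_mul, add_zero]
  refine Finset.sum_congr rfl fun i hi => ?_
  have hi' : i < m := Finset.mem_range.1 hi
  obtain ⟨j, rfl⟩ : ∃ j, m = i + j + 1 := ⟨m - 1 - i, by omega⟩
  have hj : i + j + 1 - 1 - i = j := by omega
  have hj' : i + j + 1 + 1 - (i + 1) = j + 1 := by omega
  rw [hj, hj']
  push_cast
  ring

theorem hasSum_H_sq_sub_H_sq (t : ℝ) (ht : |t| < 1) :
    HasSum (fun m : ℕ => (H (m + 1) ^ 2 - H m ^ 2) * t ^ (m + 1))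
      (Li2 t + Real.log (1 - t) ^ 2) := by
  have hlog : HasSum (fun k : ℕ => t ^ k / (k : ℝ)) (-Real.log (1 - t)) := by
    rw [← hasSum_nat_add_iff' 1]
    simpa using Real.hasSum_pow_div_log_of_abs_lt_one ht
  have hsq := hasSum_sum_range_mul_of_summable_norm hlog.summable.norm hlog.summable.norm
  rw [hlog.tsum_eq, ← hasSum_nat_add_iff' 1] at hsq
  simp only [sum_range_pow_div_mul_pow_div] at hsq
  have hLi : HasSum (fun k : ℕ => t ^ (k + 1) / ((k : ℝ) + 1) ^ 2) (Li2 t) := by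
    refine Summable.hasSum (Summable.of_norm_bounded (g := fun k : ℕ => |t| ^ k)
      (summable_geometric_of_lt_one (abs_nonneg t) ht) fun k => ?_)
    rw [Real.norm_eq_abs, abs_div, abs_pow, abs_of_pos (by positivity : (0 : ℝ) < (k + 1) ^ 2)]
    refine (div_le_self (by positivity) ?_).trans
      (pow_le_pow_of_le_one (abs_nonneg t) ht.le k.le_succ)
    have : (0 : ℝ) ≤ k := k.cast_nonneg
    nlinarith
  convert hLi.add hsq using 1
  · funext m
    rw [H_succ]
    have h1 : (m : ℝ) + 1 ≠ 0 := by positivity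
    field_simp
    ring
  · simp
    ring

theorem stmt_3 (t : ℝ) (ht : |t| < 1) :
    HasSum (fun k : ℕ => H k ^ 2 * t ^ k)
      ((Li2 t + Real.log (1 - t) ^ 2) / (1 - t)) := by
  have hd := hasSum_H_sq_sub_H_sq t ht
  have hg := hasSum_geometric_of_abs_lt_one ht
  have hprod := hasSum_sum_range_mul_of_summable_norm hd.summable.norm hg.summable.norm
  rw [hd.tsum_eq, hg.tsum_eq, ← div_eq_mul_inv] at hprod
  have hH0 : H 0 = 0 := Finset.sum_range_zero _
  rw [← hasSum_nat_add_iff' 1]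
  convert! hprod using 1
  · funext n
    have hterm : ∀ i ∈ Finset.range (n + 1),
        (H (i + 1) ^ 2 - H i ^ 2) * t ^ (i + 1) * t ^ (n - i) =
          (H (i + 1) ^ 2 - H i ^ 2) * t ^ (n + 1) := fun i hi => by
      have hi' : i < n + 1 := Finset.mem_range.1 hi
      rw [mul_assoc, ← pow_add, show i + 1 + (n - i) = n + 1 by omega]
    rw [Finset.sum_congr rfl hterm, ← Finset.sum_mul,
      Finset.sum_range_sub (fun i => H i ^ 2), hH0]
    ring
  · simp [hH0]
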